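/- Let Q be a semigroup and let q ∈ Q be such that q = a♯b for some a,b ∈ Q with b ≤_R a (so that q ≤_R a and φ̄_{a,q} is defined). If the image φ̄_{a,q}(⟨a⟩) is a finite group, then q H aᵏb for some integer k ≥ 0 (where a⁰b is understood as b). -/

import Mathlib

universe u

variable {Q : Type u}

/-- `p ≤_L q` in a semigroup `Q`: `Q¹p ⊆ Q¹q`, i.e. `p = q` or `p = x*q` for some `x`. -/
def leL [Semigroup Q] (p q : Q) : Prop := p = q ∨ ∃ x, p = x * q

/-- `p ≤_R q` in a semigroup `Q`: `pQ¹ ⊆ qQ¹`. -/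
def leR [Semigroup Q] (p q : Q) : Prop := p = q ∨ ∃ x, p = q * x

/-- Green's relation `L`. -/
def GreenL [Semigroup Q] (p q : Q) : Prop := leL p q ∧ leL q p

/-- Green's relation `R`. -/
def GreenR [Semigroup Q] (p q : Q) : Prop := leR p q ∧ leR q p

/-- Green's relation `H = L ∩ R`. -/
def GreenH [Semigroup Q] (p q : Q) : Prop := GreenL p q ∧ GreenR p q

/-- Green's relation `D = L ∘ R`. -/
def GreenD [Semigroup Q] (p q : Q) : Prop := ∃ c, GreenL p c ∧ GreenR c q

/-- `h` is the group inverse `q♯` of `q` (in the group `H`-class of `q`):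
`q` and `h` commute, `qhq = q` and `hqh = h`.  This holds precisely when `q` lies in a
subgroup of `Q` and `h` is its group inverse there. -/
def IsGroupInverse [Semigroup Q] (q h : Q) : Prop :=
  q * h = h * q ∧ q * h * q = q ∧ h * q * h = h

/-- `q` lies in a subgroup of `Q` (i.e. `q ∈ H(Q)`, the `H`-class of `q` is a group). -/
def inSubgroup [Semigroup Q] (q : Q) : Prop := ∃ h, IsGroupInverse q h

/-- A semigroup is regular if every element `q` can be written `q = qxq`. -/
def Regular (Q : Type u) [Semigroup Q] : Prop := ∀ q : Q, ∃ x, q * x * q = q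

theorem leR_refl [Semigroup Q] (a : Q) : leR a a := Or.inl rfl

theorem leR_trans [Semigroup Q] {a b c : Q} (h1 : leR a b) (h2 : leR b c) : leR a c := by
  rcases h1 with rfl | ⟨x, rfl⟩
  · exact h2
  · rcases h2 with rfl | ⟨y, rfl⟩
    · exact Or.inr ⟨x, rfl⟩
    · exact Or.inr ⟨y * x, mul_assoc _ _ _⟩

/-- The setoid of Green's relation `R` on `Q`; its quotient is the set of `R`-classes. -/
def rSetoid (Q : Type u) [Semigroup Q] : Setoid Q :=
  ⟨GreenR, ⟨fun _ => ⟨Or.inl rfl, Or.inl rfl⟩, fun h => ⟨h.2, h.1⟩,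
    fun h1 h2 => ⟨leR_trans h1.1 h2.1, leR_trans h2.2 h1.2⟩⟩⟩

/-- The set of `R`-classes of `Q`. -/
def RClasses (Q : Type u) [Semigroup Q] := Quotient (rSetoid Q)

/-- The `R`-class of an element. -/
def RClassOf [Semigroup Q] (b : Q) : RClasses Q := Quotient.mk (rSetoid Q) b

/-- The partial order on `R`-classes induced by `≤_R`. -/
instance RClasses.instPartialOrder [Semigroup Q] : PartialOrder (RClasses Q) where
  le := Quotient.lift₂ leR (fun _ _ _ _ ha hb => propext
    ⟨fun h => leR_trans (leR_trans ha.2 h) hb.1, fun h => leR_trans (leR_trans ha.1 h) hb.2⟩)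
  le_refl := by
    intro x; induction x using Quotient.ind; exact Or.inl rfl
  le_trans := by
    intro x y z
    induction x using Quotient.ind; induction y using Quotient.ind; induction z using Quotient.ind
    exact leR_trans
  le_antisymm := by
    intro x y
    induction x using Quotient.ind; induction y using Quotient.ind
    intro h1 h2; exact Quotient.sound ⟨h1, h2⟩

/-- For `a, q ∈ Q`, `ρ(a,q)` is the set of `R`-classes `{ R_b : b D q and b ≤_R a }`,
partially ordered by the order induced by `≤_R`. -/
def rho [Semigroup Q] (a q : Q) : Set (RClasses Q) :=
  { x | ∃ b : Q, x = RClassOf b ∧ GreenD b q ∧ leR b a }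

/-- `npow1 x n = x^(n+1)` in a semigroup. -/
def npow1 [Semigroup Q] (x : Q) : ℕ → Q
  | 0 => x
  | n + 1 => npow1 x n * x

/-- Integer powers of an element `a` lying in a subgroup, with group inverse `a'`:
`gpow a a' 0 = a * a'` (the identity of the group `H`-class), `gpow a a' n = aⁿ` for
`n > 0` and `gpow a a' (-n) = (a')ⁿ` for `n > 0`.  The set of all these powers is the
cyclic subgroup `⟨a⟩` of `H_a` generated by `a`. -/
def gpow [Semigroup Q] (a a' : Q) : ℤ → Q
  | Int.ofNat 0 => a * a'
  | Int.ofNat (n + 1) => npow1 a n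
  | Int.negSucc n => npow1 a' n

/-- `npowMul a b k = aᵏ * b`, with `a⁰ * b` understood as `b`. -/
def npowMul [Semigroup Q] (a b : Q) : ℕ → Q
  | 0 => b
  | k + 1 => a * npowMul a b k

theorem GreenR.mul_left [Semigroup Q] {x y : Q} (h : GreenR x y) (c : Q) :
    GreenR (c * x) (c * y) := by
  have key : ∀ {u v : Q}, leR u v → leR (c * u) (c * v) := by
    rintro u v (rfl | ⟨z, rfl⟩)
    · exact leR_refl _
    · exact Or.inr ⟨z, (mul_assoc _ _ _).symm⟩
  exact ⟨key h.1, key h.2⟩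

theorem GreenD.refl [Semigroup Q] (q : Q) : GreenD q q :=
  ⟨q, ⟨Or.inl rfl, Or.inl rfl⟩, leR_refl q, leR_refl q⟩

/-- Left multiplication by `a` is a permutation of the elements fixed by the identity `a * a'`
of the group `H`-class of `a`, with inverse left multiplication by `a'`. -/
def IsGroupInverse.leftPerm [Semigroup Q] {a a' : Q} (ha : IsGroupInverse a a') :
    Equiv.Perm {x : Q // a * a' * x = x} where
  toFun x := ⟨a * x, by rw [← mul_assoc, ha.2.1]⟩
  invFun x := ⟨a' * x, by
    rw [← mul_assoc, show a * a' * a' = a' by rw [ha.1, ha.2.2]]⟩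
  left_inv x := Subtype.ext (by
    change a' * (a * (x : Q)) = x
    rw [← mul_assoc, ← ha.1, x.2])
  right_inv x := Subtype.ext (by
    change a * (a' * (x : Q)) = x
    rw [← mul_assoc, x.2])

theorem IsGroupInverse.leftPerm_coe [Semigroup Q] {a a' : Q} (ha : IsGroupInverse a a')
    (x : {x : Q // a * a' * x = x}) : (ha.leftPerm x : Q) = a * x := rfl

theorem IsGroupInverse.leftPerm_inv_coe [Semigroup Q] {a a' : Q} (ha : IsGroupInverse a a')
    (x : {x : Q // a * a' * x = x}) : (ha.leftPerm⁻¹ x : Q) = a' * x := rfl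

theorem IsGroupInverse.leftPerm_zpow_coe [Semigroup Q] {a a' : Q} (ha : IsGroupInverse a a')
    (i : ℤ) (x : {x : Q // a * a' * x = x}) :
    ((ha.leftPerm ^ i) x : Q) = gpow a a' i * x := by
  match i with
  | Int.ofNat 0 => exact x.2.symm
  | Int.ofNat (n + 1) =>
    change ((ha.leftPerm ^ (n + 1)) x : Q) = npow1 a n * x
    induction n generalizing x with
    | zero => simp [npow1, leftPerm_coe]
    | succ n ih =>
      rw [pow_succ, Equiv.Perm.mul_apply, ih, leftPerm_coe, npow1, mul_assoc]
  | Int.negSucc n =>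
    rw [zpow_negSucc, ← inv_pow]
    change ((ha.leftPerm⁻¹ ^ (n + 1)) x : Q) = npow1 a' n * x
    induction n generalizing x with
    | zero => simp only [zero_add, pow_one, npow1, leftPerm_inv_coe]
    | succ n ih =>
      rw [pow_succ, Equiv.Perm.mul_apply, ih, leftPerm_inv_coe, npow1, mul_assoc]

theorem IsGroupInverse.leftPerm_pow_coe [Semigroup Q] {a a' : Q} (ha : IsGroupInverse a a')
    (k : ℕ) (x : {x : Q // a * a' * x = x}) :
    ((ha.leftPerm ^ k) x : Q) = npowMul a x k := by
  induction k with
  | zero => rfl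
  | succ k ih => rw [pow_succ', Equiv.Perm.mul_apply, leftPerm_coe, ih, npowMul]

theorem IsGroupInverse.greenL_leftPerm_zpow [Semigroup Q] {a a' : Q} (ha : IsGroupInverse a a')
    (i : ℤ) (x : {x : Q // a * a' * x = x}) : GreenL (x : Q) ((ha.leftPerm ^ i) x : Q) := by
  refine ⟨Or.inr ⟨gpow a a' (-i), ?_⟩, Or.inr ⟨gpow a a' i, ha.leftPerm_zpow_coe i x⟩⟩
  rw [← ha.leftPerm_zpow_coe, ← Equiv.Perm.mul_apply, ← zpow_add, neg_add_cancel, zpow_zero,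
    Equiv.Perm.one_apply]

/-- Lemma 3.7: let `Q` be a semigroup and `q ∈ Q` with `q = a♯ * b` for some `a, b ∈ Q`
with `b ≤_R a`.  If the image `φ̄(⟨a⟩)` of the homomorphism `φ̄ = φ̄_{a,q} : ⟨a⟩ →
A(ρ(a,q))`, `aⁱ ↦ φ_{aⁱ}`, is finite, then `q H aᵏ * b` for some integer `k ≥ 0` (where
`a⁰ * b` is understood as `b`). -/
theorem finite_image_H {Q : Type u} [Semigroup Q] (q a b asharp : Q)
    (ha : IsGroupInverse a asharp) (hb : leR b a) (hq : q = asharp * b)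
    (Phi : ℤ → (↥(rho a q) ≃o ↥(rho a q)))
    (hPhi : ∀ (i : ℤ) (c : Q) (hc : RClassOf c ∈ rho a q),
      ((Phi i) ⟨RClassOf c, hc⟩ : RClasses Q) = RClassOf (gpow a asharp i * c))
    (hfin : (Set.range Phi).Finite) :
    ∃ k : ℕ, GreenH q (npowMul a b k) := by
  have hbfix : a * asharp * b = b := by
    rcases hb with rfl | ⟨x, rfl⟩
    · exact ha.2.1
    · rw [← mul_assoc, ha.2.1]
  let b' : {x : Q // a * asharp * x = x} := ⟨b, hbfix⟩
  let f := ha.leftPerm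
  have hqb : ((f⁻¹ b' : {x : Q // a * asharp * x = x}) : Q) = q := hq.symm
  have hqa : leR q a := Or.inr ⟨asharp * q, by
    rw [← mul_assoc, ← hqb, (f⁻¹ b').2]⟩
  have hqrho : RClassOf q ∈ rho a q := ⟨q, rfl, GreenD.refl q, hqa⟩
  obtain ⟨i, j, hij, hPhi_eq⟩ : ∃ i j : ℤ, i < j ∧ Phi i = Phi j := by
    have hninj : ¬ Function.Injective Phi := fun hinj =>
      Set.infinite_range_of_injective hinj hfin
    obtain ⟨i, j, h, hne⟩ := Function.not_injective_iff.mp hninj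
    rcases hne.lt_or_gt with hlt | hlt
    · exact ⟨i, j, hlt, h⟩
    · exact ⟨j, i, hlt, h.symm⟩
  have hR : GreenR (gpow a asharp i * q) (gpow a asharp j * q) :=
    Quotient.exact (by
      change RClassOf (gpow a asharp i * q) = RClassOf (gpow a asharp j * q)
      rw [← hPhi i q hqrho, ← hPhi j q hqrho, hPhi_eq])
  obtain ⟨k, hk⟩ : ∃ k : ℕ, j = i + (k + 1) := ⟨(j - i - 1).toNat, by omega⟩
  have hpow : (f ^ ((k : ℤ) + 1)) (f⁻¹ b') = (f ^ k) b' := by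
    rw [← Equiv.Perm.mul_apply, zpow_add_one, mul_inv_cancel_right, zpow_natCast]
  have hshift (m : ℤ) : gpow a asharp (-i) * (gpow a asharp m * q) =
      ((f ^ (-i + m)) (f⁻¹ b') : {x : Q // a * asharp * x = x}) := by
    rw [← hqb, ← ha.leftPerm_zpow_coe, ← ha.leftPerm_zpow_coe, zpow_add, Equiv.Perm.mul_apply]
  have hR' := hR.mul_left (gpow a asharp (-i))
  rw [hshift, hshift, neg_add_cancel, zpow_zero, Equiv.Perm.one_apply, hk, neg_add_cancel_left,
    hpow, ha.leftPerm_pow_coe, hqb] at hR'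
  have hL := ha.greenL_leftPerm_zpow ((k : ℤ) + 1) (f⁻¹ b')
  rw [hpow, ha.leftPerm_pow_coe, hqb] at hL
  exact ⟨k, hL, hR'⟩
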